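/- If f: ℝ^N → ℝ≥0 is log-concave and K ⊆ ℝ^N is a convex body, then the function z ↦ ∫_{z + K} f(w) dw is log-concave in z. -/

import Mathlib

open MeasureTheory Set

def LogConcave {N : ℕ} (f : (Fin N → ℝ) → ℝ) : Prop :=
  (∀ x, 0 ≤ f x) ∧
    ∀ x y θ, θ ∈ Set.Ioo (0 : ℝ) 1 →
      f x ^ θ * f y ^ (1 - θ) ≤ f (θ • x + (1 - θ) • y)

open scoped ENNReal

/-- The one-dimensional Brunn-Minkowski inequality for compact sets. -/
theorem volume_add_le_of_isCompact {A B C : Set ℝ} (hA : IsCompact A) (hB : IsCompact B)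
    (hAn : A.Nonempty) (hBn : B.Nonempty) (hC : ∀ a ∈ A, ∀ b ∈ B, a + b ∈ C) :
    volume A + volume B ≤ volume C := by
  obtain ⟨a, ha, ha_max⟩ := hA.exists_isGreatest hAn
  obtain ⟨b, hb, hb_min⟩ := hB.exists_isLeast hBn
  set A' : Set ℝ := (fun x => -b + x) ⁻¹' A
  set B' : Set ℝ := (fun x => -a + x) ⁻¹' B
  have hB'm : MeasurableSet B' := (measurable_const_add (-a)) hB.measurableSet
  have hdisj : AEDisjoint volume A' B' := by
    refine measure_mono_null (t := {a + b}) ?_ (by simp)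
    rintro x ⟨hxA, hxB⟩
    have h1 := ha_max hxA
    have h2 := hb_min hxB
    simp only [mem_singleton_iff]
    linarith
  calc volume A + volume B = volume A' + volume B' := by
        simp only [A', B', measure_preimage_add]
    _ = volume (A' ∪ B') := (measure_union₀ hB'm.nullMeasurableSet hdisj).symm
    _ ≤ volume C := by
        refine measure_mono ?_
        rintro x (hx | hx)
        · simpa using hC _ hx b hb
        · simpa using hC a ha _ hx

/-- The one-dimensional Brunn-Minkowski inequality for measurable sets. -/
theorem volume_add_le_of_measurableSet {A B C : Set ℝ} (hA : MeasurableSet A)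
    (hB : MeasurableSet B) (hAn : A.Nonempty) (hBn : B.Nonempty)
    (hC : ∀ a ∈ A, ∀ b ∈ B, a + b ∈ C) :
    volume A + volume B ≤ volume C := by
  obtain ⟨a, ha⟩ := hAn
  obtain ⟨b, hb⟩ := hBn
  rw [hA.measure_eq_iSup_isCompact, hB.measure_eq_iSup_isCompact]
  simp only [iSup_and']
  refine ENNReal.biSup_add_biSup_le' ⟨∅, by simp⟩ ⟨∅, by simp⟩ ?_
  rintro K ⟨hKA, hK⟩ L ⟨hLB, hL⟩
  calc volume K + volume L ≤ volume (insert a K) + volume (insert b L) :=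
        add_le_add (measure_mono (subset_insert _ _)) (measure_mono (subset_insert _ _))
    _ ≤ volume C := volume_add_le_of_isCompact (hK.insert a) (hL.insert b)
        (insert_nonempty _ _) (insert_nonempty _ _) fun x hx y hy =>
          hC x (insert_subset ha hKA hx) y (insert_subset hb hLB hy)

theorem volume_convexCombo_le {A B C : Set ℝ} {θ : ℝ} (hθ : θ ∈ Ioo (0 : ℝ) 1)
    (hA : MeasurableSet A) (hB : MeasurableSet B) (hAn : A.Nonempty) (hBn : B.Nonempty)
    (hC : ∀ a ∈ A, ∀ b ∈ B, θ * a + (1 - θ) * b ∈ C) :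
    ENNReal.ofReal θ * volume A + ENNReal.ofReal (1 - θ) * volume B ≤ volume C := by
  have hscale : ∀ (r : ℝ) (S : Set ℝ), 0 < r →
      ENNReal.ofReal r * volume S = volume ((r * ·) '' S) := by
    intro r S hr
    have := Measure.addHaar_smul (volume : Measure ℝ) r S
    simp only [Module.finrank_self, pow_one, abs_of_pos hr] at this
    exact this.symm
  have hmeas : ∀ (r : ℝ) (S : Set ℝ), 0 < r → MeasurableSet S →
      MeasurableSet ((r * ·) '' S) := fun r S hr hS =>
    (measurableEmbedding_mulLeft₀ hr.ne').measurableSet_image.2 hS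
  have h1 : 0 < 1 - θ := sub_pos.2 hθ.2
  rw [hscale θ A hθ.1, hscale (1 - θ) B h1]
  refine volume_add_le_of_measurableSet (hmeas _ _ hθ.1 hA) (hmeas _ _ h1 hB)
    (hAn.image _) (hBn.image _) ?_
  rintro _ ⟨a, ha, rfl⟩ _ ⟨b, hb, rfl⟩
  exact hC a ha b hb

theorem lintegral_eq_lintegral_Ioo_meas_lt {α : Type*} [MeasurableSpace α] (μ : Measure α)
    {f : α → ℝ≥0∞} (hf : Measurable f) (hf1 : ∀ x, f x ≤ 1) :
    ∫⁻ x, f x ∂μ = ∫⁻ t in Ioo (0 : ℝ) 1, μ {x | ENNReal.ofReal t < f x} := by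
  have hfin : ∀ x, f x ≠ ∞ := fun x => ne_top_of_le_ne_top ENNReal.one_ne_top (hf1 x)
  have hlayer := lintegral_eq_lintegral_meas_lt μ (f := fun x => (f x).toReal)
    (Filter.Eventually.of_forall fun x => ENNReal.toReal_nonneg) hf.ennreal_toReal.aemeasurable
  simp only [ENNReal.ofReal_toReal (hfin _)] at hlayer
  rw [hlayer, ← lintegral_indicator measurableSet_Ioi, ← lintegral_indicator measurableSet_Ioo]
  congr 1 with t
  by_cases h0 : 0 < t
  · by_cases h1 : t < 1
    · simp [h0, h1, ENNReal.ofReal_lt_iff_lt_toReal h0.le (hfin _)]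
    · have : {x | t < (f x).toReal} = ∅ := by
        ext x
        have := ENNReal.toReal_mono ENNReal.one_ne_top (hf1 x)
        simp only [ENNReal.toReal_one] at this
        simp only [mem_ofPred_eq, mem_empty_iff_false, iff_false, not_lt]
        linarith
      simp [h0, h1, this]
  · simp [h0]

theorem ENNReal.geom_mean_le_arith_mean {θ : ℝ} (hθ : θ ∈ Ioo (0 : ℝ) 1) (a b : ℝ≥0∞) :
    a ^ θ * b ^ (1 - θ) ≤ ENNReal.ofReal θ * a + ENNReal.ofReal (1 - θ) * b := by
  have h0 : 0 < θ := hθ.1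
  have h1 : 0 < 1 - θ := sub_pos.2 hθ.2
  have hpq : (θ⁻¹).HolderConjugate (1 - θ)⁻¹ := by
    rw [Real.holderConjugate_iff]
    exact ⟨(one_lt_inv₀ h0).2 hθ.2, by simp⟩
  have := ENNReal.young_inequality (a ^ θ) (b ^ (1 - θ)) hpq
  rwa [← ENNReal.rpow_mul, ← ENNReal.rpow_mul, mul_inv_cancel₀ h0.ne', mul_inv_cancel₀ h1.ne',
    ENNReal.rpow_one, ENNReal.rpow_one, ENNReal.ofReal_inv_of_pos h0,
    ENNReal.ofReal_inv_of_pos h1, div_eq_mul_inv, div_eq_mul_inv, inv_inv, inv_inv,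
    mul_comm a, mul_comm b] at this

theorem ENNReal.lt_rpow_mul_rpow {θ : ℝ} (hθ : θ ∈ Ioo (0 : ℝ) 1) {s a b : ℝ≥0∞}
    (hs : s ≠ 0) (ha : s < a) (hb : s < b) : s < a ^ θ * b ^ (1 - θ) := by
  have h1 : 0 < 1 - θ := sub_pos.2 hθ.2
  calc s = s ^ θ * s ^ (1 - θ) := by
        rw [← ENNReal.rpow_add _ _ hs ha.ne_top]; simp
    _ < a ^ θ * b ^ (1 - θ) :=
        ENNReal.mul_lt_mul (ENNReal.rpow_lt_rpow ha hθ.1) (ENNReal.rpow_lt_rpow hb h1)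

theorem lintegral_convexCombo_le_of_iSup_eq_one {θ : ℝ} (hθ : θ ∈ Ioo (0 : ℝ) 1)
    {f g h : ℝ → ℝ≥0∞} (hf : Measurable f) (hg : Measurable g) (hh : Measurable h)
    (hf1 : ⨆ x, f x = 1) (hg1 : ⨆ x, g x = 1)
    (hfgh : ∀ x y, f x ^ θ * g y ^ (1 - θ) ≤ h (θ • x + (1 - θ) • y)) :
    ENNReal.ofReal θ * (∫⁻ x, f x) + ENNReal.ofReal (1 - θ) * ∫⁻ x, g x ≤ ∫⁻ x, h x := by
  have hmono : ∀ φ : ℝ → ℝ≥0∞, Measurable fun t : ℝ => volume {x | ENNReal.ofReal t < φ x} := by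
    intro φ
    refine Antitone.measurable fun s t hst => measure_mono fun x hx => ?_
    exact (ENNReal.ofReal_le_ofReal hst).trans_lt hx
  calc ENNReal.ofReal θ * (∫⁻ x, f x) + ENNReal.ofReal (1 - θ) * ∫⁻ x, g x
      = ∫⁻ t in Ioo (0 : ℝ) 1, (ENNReal.ofReal θ * volume {x | ENNReal.ofReal t < f x} +
          ENNReal.ofReal (1 - θ) * volume {x | ENNReal.ofReal t < g x}) := by
        rw [lintegral_eq_lintegral_Ioo_meas_lt _ hf fun x => hf1 ▸ le_iSup f x,
          lintegral_eq_lintegral_Ioo_meas_lt _ hg fun x => hg1 ▸ le_iSup g x,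
          lintegral_add_left ((hmono f).const_mul _), lintegral_const_mul _ (hmono f),
          lintegral_const_mul _ (hmono g)]
    _ ≤ ∫⁻ t in Ioo (0 : ℝ) 1, volume {x | ENNReal.ofReal t < min (h x) 1} := by
        refine setLIntegral_mono' measurableSet_Ioo fun t ht => ?_
        have ht1 : ENNReal.ofReal t < 1 := by
          rw [← ENNReal.ofReal_one]
          exact (ENNReal.ofReal_lt_ofReal_iff one_pos).2 ht.2
        refine volume_convexCombo_le hθ (measurableSet_lt measurable_const hf)
          (measurableSet_lt measurable_const hg) (lt_iSup_iff.1 (ht1.trans_eq hf1.symm))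
          (lt_iSup_iff.1 (ht1.trans_eq hg1.symm)) fun x hx y hy => lt_min ?_ ht1
        exact (ENNReal.lt_rpow_mul_rpow hθ (ENNReal.ofReal_pos.2 ht.1).ne' hx hy).trans_le
          (hfgh x y)
    _ = ∫⁻ x, min (h x) 1 :=
        (lintegral_eq_lintegral_Ioo_meas_lt _ (hh.min measurable_const)
          fun x => min_le_right _ _).symm
    _ ≤ ∫⁻ x, h x := lintegral_mono fun x => min_le_left _ _

/-- The Prékopa-Leindler inequality with weights `θ` and `1 - θ` holds for the measure `μ`. -/
def PrekopaLeindler {E : Type*} [AddCommGroup E] [Module ℝ E] [MeasurableSpace E]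
    (μ : Measure E) (θ : ℝ) : Prop :=
  ∀ f g h : E → ℝ≥0∞, Measurable f → Measurable g → Measurable h →
    (∀ x y, f x ^ θ * g y ^ (1 - θ) ≤ h (θ • x + (1 - θ) • y)) →
    (∫⁻ x, f x ∂μ) ^ θ * (∫⁻ x, g x ∂μ) ^ (1 - θ) ≤ ∫⁻ x, h x ∂μ

theorem prekopaLeindler_real_of_iSup_ne_top {θ : ℝ} (hθ : θ ∈ Ioo (0 : ℝ) 1)
    {f g h : ℝ → ℝ≥0∞} (hf : Measurable f) (hg : Measurable g) (hh : Measurable h)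
    (hfb : ⨆ x, f x ≠ ∞) (hgb : ⨆ x, g x ≠ ∞)
    (hfgh : ∀ x y, f x ^ θ * g y ^ (1 - θ) ≤ h (θ • x + (1 - θ) • y)) :
    (∫⁻ x, f x) ^ θ * (∫⁻ x, g x) ^ (1 - θ) ≤ ∫⁻ x, h x := by
  have h0 : 0 < θ := hθ.1
  have h1 : 0 < 1 - θ := sub_pos.2 hθ.2
  set M := ⨆ x, f x with hM
  set L := ⨆ x, g x with hL
  by_cases hM0 : M = 0
  · have : ∀ x, f x = 0 := ENNReal.iSup_eq_zero.1 hM0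
    simp [this, h0]
  by_cases hL0 : L = 0
  · have : ∀ x, g x = 0 := ENNReal.iSup_eq_zero.1 hL0
    simp [this, hθ.2]
  set c := M ^ θ * L ^ (1 - θ) with hc
  have hc0 : c ≠ 0 := mul_ne_zero (by simp [hM0, hfb]) (by simp [hL0, hgb])
  have hct : c ≠ ∞ := ENNReal.mul_ne_top (ENNReal.rpow_ne_top_of_nonneg h0.le hfb)
    (ENNReal.rpow_ne_top_of_nonneg h1.le hgb)
  have hcinv : c⁻¹ = M⁻¹ ^ θ * L⁻¹ ^ (1 - θ) := by
    rw [hc, ENNReal.mul_inv (.inl (by simp [hM0, hfb]))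
      (.inr (by simp [hL0, hgb])), ENNReal.inv_rpow, ENNReal.inv_rpow]
  have hnorm : ∀ a b : ℝ≥0∞,
      (M⁻¹ * a) ^ θ * (L⁻¹ * b) ^ (1 - θ) = c⁻¹ * (a ^ θ * b ^ (1 - θ)) := by
    intro a b
    rw [ENNReal.mul_rpow_of_nonneg _ _ h0.le, ENNReal.mul_rpow_of_nonneg _ _ h1.le, hcinv]
    ring
  have key := lintegral_convexCombo_le_of_iSup_eq_one hθ (hf.const_mul M⁻¹) (hg.const_mul L⁻¹)
    (hh.const_mul c⁻¹) (by rw [← ENNReal.mul_iSup, ENNReal.inv_mul_cancel hM0 hfb])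
    (by rw [← ENNReal.mul_iSup, ENNReal.inv_mul_cancel hL0 hgb])
    (fun x y => by rw [hnorm]; gcongr; exact hfgh x y)
  have := (ENNReal.geom_mean_le_arith_mean hθ _ _).trans key
  rw [lintegral_const_mul _ hf, lintegral_const_mul _ hg, lintegral_const_mul _ hh, hnorm] at this
  exact (ENNReal.mul_le_mul_iff_right (ENNReal.inv_ne_zero.2 hct) (ENNReal.inv_ne_top.2 hc0)).1 this

theorem tendsto_lintegral_min_natCast {α : Type*} [MeasurableSpace α] (μ : Measure α)
    {f : α → ℝ≥0∞} (hf : Measurable f) :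
    Filter.Tendsto (fun n : ℕ => ∫⁻ x, min (f x) n ∂μ) Filter.atTop (nhds (∫⁻ x, f x ∂μ)) := by
  refine lintegral_tendsto_of_tendsto_of_monotone
    (fun n => (hf.min measurable_const).aemeasurable) ?_ ?_
  · exact Filter.Eventually.of_forall fun x m n hmn => by dsimp only; gcongr
  · refine Filter.Eventually.of_forall fun x => ?_
    simpa using tendsto_const_nhds.min ENNReal.tendsto_nat_nhds_top

theorem prekopaLeindler_real {θ : ℝ} (hθ : θ ∈ Ioo (0 : ℝ) 1) :
    PrekopaLeindler (volume : Measure ℝ) θ := by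
  intro f g h hf hg hh hfgh
  have h0 : 0 < θ := hθ.1
  have h1 : 0 < 1 - θ := sub_pos.2 hθ.2
  by_cases hf0 : ∫⁻ x, f x = 0
  · simp [hf0, h0]
  by_cases hg0 : ∫⁻ x, g x = 0
  · simp [hg0, hθ.2]
  have hlim := ENNReal.Tendsto.mul
    ((ENNReal.continuous_rpow_const (y := θ)).continuousAt.tendsto.comp
      (tendsto_lintegral_min_natCast volume hf))
    (.inl (by simp [hf0, h0.not_gt]))
    ((ENNReal.continuous_rpow_const (y := 1 - θ)).continuousAt.tendsto.comp
      (tendsto_lintegral_min_natCast volume hg))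
    (.inl (by simp [hg0, h1.not_gt]))
  refine le_of_tendsto' hlim fun n => ?_
  have hbdd : ∀ φ : ℝ → ℝ≥0∞, ⨆ x, min (φ x) n ≠ ∞ := fun φ =>
    ne_top_of_le_ne_top (ENNReal.natCast_ne_top n) (iSup_le fun x => min_le_right _ _)
  refine prekopaLeindler_real_of_iSup_ne_top hθ (hf.min measurable_const)
    (hg.min measurable_const) hh (hbdd f) (hbdd g) fun x y => le_trans ?_ (hfgh x y)
  exact mul_le_mul' (ENNReal.rpow_le_rpow (min_le_left _ _) h0.le)
    (ENNReal.rpow_le_rpow (min_le_left _ _) h1.le)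

theorem PrekopaLeindler.prod {E F : Type*} [AddCommGroup E] [Module ℝ E] [MeasurableSpace E]
    [AddCommGroup F] [Module ℝ F] [MeasurableSpace F] {μ : Measure E} {ν : Measure F}
    [SFinite ν] {θ : ℝ} (hμ : PrekopaLeindler μ θ) (hν : PrekopaLeindler ν θ) :
    PrekopaLeindler (μ.prod ν) θ := by
  intro f g h hf hg hh hfgh
  rw [lintegral_prod _ hf.aemeasurable, lintegral_prod _ hg.aemeasurable,
    lintegral_prod _ hh.aemeasurable]
  refine hμ _ _ _ hf.lintegral_prod_right' hg.lintegral_prod_right' hh.lintegral_prod_right'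
    fun x y => ?_
  exact hν _ _ _ (hf.comp measurable_prodMk_left) (hg.comp measurable_prodMk_left)
    (hh.comp measurable_prodMk_left) fun u v => hfgh (x, u) (y, v)

theorem PrekopaLeindler.of_measurePreserving {E F : Type*} [AddCommGroup E] [Module ℝ E]
    [MeasurableSpace E] [AddCommGroup F] [Module ℝ F] [MeasurableSpace F] {μ : Measure E}
    {ν : Measure F} {θ : ℝ} (hμ : PrekopaLeindler μ θ) {e : E → F}
    (he : MeasurePreserving e μ ν)
    (hlin : ∀ x y, e (θ • x + (1 - θ) • y) = θ • e x + (1 - θ) • e y) :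
    PrekopaLeindler ν θ := by
  intro f g h hf hg hh hfgh
  rw [← he.lintegral_comp hf, ← he.lintegral_comp hg, ← he.lintegral_comp hh]
  exact hμ _ _ _ (hf.comp he.measurable) (hg.comp he.measurable) (hh.comp he.measurable)
    fun x y => by simpa only [Function.comp_apply, hlin] using hfgh (e x) (e y)

theorem prekopaLeindler_pi {θ : ℝ} (hθ : θ ∈ Ioo (0 : ℝ) 1) (N : ℕ) :
    PrekopaLeindler (volume : Measure (Fin N → ℝ)) θ := by
  induction N with
  | zero =>
    intro f g h _ _ _ hfgh
    have hvol : (volume : Measure (Fin 0 → ℝ)) univ = 1 := by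
      simp [volume_pi]
    simp only [lintegral_unique, hvol, mul_one]
    convert hfgh default default
  | succ n ih =>
    refine ((prekopaLeindler_real hθ).prod ih).of_measurePreserving
      (volume_preserving_piFinSuccAbove (fun _ : Fin (n + 1) => ℝ) 0).symm fun x y => ?_
    ext i
    refine Fin.cases ?_ (fun j => ?_) i <;>
      simp [MeasurableEquiv.piFinSuccAbove, Fin.insertNthEquiv]

theorem AEMeasurable.exists_measurable_ge_ae_eq {α : Type*} [MeasurableSpace α] {μ : Measure α}
    {f : α → ℝ≥0∞} (hf : AEMeasurable f μ) :
    ∃ g, Measurable g ∧ (∀ x, f x ≤ g x) ∧ f =ᵐ[μ] g := by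
  classical
  obtain ⟨t, hst, ht, ht0⟩ := exists_measurable_superset_of_null (ae_iff.1 hf.ae_eq_mk)
  refine ⟨t.piecewise (fun _ => ∞) (hf.mk f), measurable_const.piecewise ht hf.measurable_mk,
    fun x => ?_, ?_⟩
  · by_cases hx : x ∈ t
    · simp [hx]
    · have : f x = hf.mk f x := not_not.1 fun hne => hx (hst hne)
      simp [hx, this]
  · filter_upwards [hf.ae_eq_mk, measure_eq_zero_iff_ae_notMem.1 ht0] with x hx hxt
    simp [hxt, hx]

/-- The Prékopa-Leindler inequality without measurability assumptions on `f` and `g`. -/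
theorem PrekopaLeindler.lintegral_le {E : Type*} [AddCommGroup E] [Module ℝ E]
    [MeasurableSpace E] {μ : Measure E} {θ : ℝ} (hμ : PrekopaLeindler μ θ)
    (hθ : θ ∈ Ioo (0 : ℝ) 1) {f g h : E → ℝ≥0∞} (hh : AEMeasurable h μ)
    (hfgh : ∀ x y, f x ^ θ * g y ^ (1 - θ) ≤ h (θ • x + (1 - θ) • y)) :
    (∫⁻ x, f x ∂μ) ^ θ * (∫⁻ x, g x ∂μ) ^ (1 - θ) ≤ ∫⁻ x, h x ∂μ := by
  obtain ⟨f', hf'm, hf'le, hf'⟩ := exists_measurable_le_lintegral_eq μ f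
  obtain ⟨g', hg'm, hg'le, hg'⟩ := exists_measurable_le_lintegral_eq μ g
  obtain ⟨h', hh'm, hh'ge, hh'⟩ := hh.exists_measurable_ge_ae_eq
  rw [hf', hg', lintegral_congr_ae hh']
  refine hμ f' g' h' hf'm hg'm hh'm fun x y => ?_
  exact (mul_le_mul' (ENNReal.rpow_le_rpow (hf'le x) hθ.1.le)
    (ENNReal.rpow_le_rpow (hg'le y) (sub_nonneg.2 hθ.2.le))).trans
      ((hfgh x y).trans (hh'ge _))

/-- If `f` is a log-concave probability density and `K` is a convex body, then
`z ↦ ∫_{z + K} f` is log-concave in `z`. -/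
theorem logConcave_translate_convex_body {N : ℕ} (f : (Fin N → ℝ) → ℝ)
    (hf : LogConcave f) (hint : Integrable f) (hprob : ∫ x, f x = 1)
    (K : Set (Fin N → ℝ)) (hK : Convex ℝ K) (hKc : IsCompact K)
    (hKint : (interior K).Nonempty) :
    LogConcave (fun z => ∫ w in (fun k => z + k) '' K, f w) := by
  obtain ⟨hf0, hfc⟩ := hf
  refine ⟨fun z => integral_nonneg hf0, fun x y θ hθ => ?_⟩
  have h0 : 0 < θ := hθ.1
  have h1 : 0 < 1 - θ := sub_pos.2 hθ.2
  have hmeas : ∀ z : Fin N → ℝ, MeasurableSet ((fun k => z + k) '' K) := fun z =>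
    (hKc.image (continuous_const_add z)).measurableSet
  set Φ : (Fin N → ℝ) → (Fin N → ℝ) → ℝ≥0∞ := fun z =>
    ((fun k => z + k) '' K).indicator fun w => ENNReal.ofReal (f w) with hΦ
  have hval : ∀ z, ∫ w in (fun k => z + k) '' K, f w = (∫⁻ w, Φ z w).toReal := fun z => by
    rw [lintegral_indicator (hmeas z), integral_eq_lintegral_of_nonneg_ae
      (Filter.Eventually.of_forall hf0) hint.aestronglyMeasurable.restrict]
  have hfin : ∀ z, ∫⁻ w, Φ z w ≠ ∞ := fun z => by
    rw [lintegral_indicator (hmeas z), ← ofReal_integral_eq_lintegral_ofReal hint.restrict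
      (Filter.Eventually.of_forall hf0)]
    exact ENNReal.ofReal_ne_top
  simp only [hval, ENNReal.toReal_rpow, ← ENNReal.toReal_mul]
  refine ENNReal.toReal_mono (hfin _) ((prekopaLeindler_pi hθ N).lintegral_le hθ
    (hint.aemeasurable.ennreal_ofReal.indicator (hmeas _)) fun u v => ?_)
  by_cases hu : u ∈ (fun k => x + k) '' K
  · by_cases hv : v ∈ (fun k => y + k) '' K
    · have huv : θ • u + (1 - θ) • v ∈ (fun k => (θ • x + (1 - θ) • y) + k) '' K := by
        obtain ⟨k, hk, rfl⟩ := hu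
        obtain ⟨l, hl, rfl⟩ := hv
        exact ⟨θ • k + (1 - θ) • l, hK hk hl h0.le h1.le (by ring), by
          simp only [smul_add]; abel⟩
      simp only [hΦ, indicator_of_mem hu, indicator_of_mem hv, indicator_of_mem huv]
      rw [ENNReal.ofReal_rpow_of_nonneg (hf0 u) h0.le, ENNReal.ofReal_rpow_of_nonneg (hf0 v) h1.le,
        ← ENNReal.ofReal_mul (Real.rpow_nonneg (hf0 u) _)]
      exact ENNReal.ofReal_le_ofReal (hfc u v θ hθ)
    · have : Φ y v = 0 := indicator_of_notMem hv _
      simp [this, ENNReal.zero_rpow_of_pos h1]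
  · have : Φ x u = 0 := indicator_of_notMem hu _
    simp [this, ENNReal.zero_rpow_of_pos h0]
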